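/- The Prime Number Theorem lim_{x→∞} ψ(x)/x = 1 holds if and only if the function x ↦ ψ(x)/x is slowly decreasing at infinity, i.e. lim_{λ→1⁺} liminf_{x→∞} ( ψ(λx)/(λx) − ψ(x)/x ) ≥ 0. -/

import Mathlib

open Filter Set ArithmeticFunction

/-- The Chebyshev prime counting function `ψ(x) = ∑_{n ≤ x} Λ(n)`, where `Λ`
is the von Mangoldt function. -/
noncomputable def chebyshevPsi (x : ℝ) : ℝ := ∑ n ∈ Finset.Iic ⌊x⌋₊, Λ n

/-- `u : [0,∞) → ℝ` is slowly decreasing at infinity: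
`lim_{λ→1⁺} liminf_{x→∞} (u(λx) − u(x)) ≥ 0`, the outer limit being understood
as a lower limit, and values taken in `EReal` so that the lower limits always exist. -/
def SlowlyDecreasing (u : ℝ → ℝ) : Prop :=
  (0 : EReal) ≤
    liminf (fun lam : ℝ =>
      liminf (fun x : ℝ => ((u (lam * x) - u x : ℝ) : EReal)) atTop)
      (nhdsWithin 1 (Ioi 1))

open MeasureTheory Topology

/-- The Fejér kernel, normalised to take the value `1` at the origin. -/
noncomputable def fejerKernel (x : ℝ) : ℝ := Real.sinc (x / 2) ^ 2

theorem fejerKernel_nonneg (x : ℝ) : 0 ≤ fejerKernel x := sq_nonneg _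

@[fun_prop]
theorem continuous_fejerKernel : Continuous fejerKernel := by
  unfold fejerKernel
  exact (Real.continuous_sinc.comp (continuous_id.div_const 2)).pow 2

theorem fejerKernel_zero : fejerKernel 0 = 1 := by simp [fejerKernel]

theorem integrable_fejerKernel : Integrable fejerKernel := by
  refine (integrable_inv_one_add_sq.const_mul 5).mono' continuous_fejerKernel.aestronglyMeasurable
    (.of_forall fun x => ?_)
  rw [Real.norm_of_nonneg (fejerKernel_nonneg x), ← div_eq_mul_inv, le_div_iff₀ (by positivity)]
  rcases eq_or_ne x 0 with rfl | hx
  · norm_num [fejerKernel_zero]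
  · have h1 : fejerKernel x ≤ 1 := by
      have := Real.abs_sinc_le_one (x / 2)
      rw [fejerKernel, ← sq_abs]
      exact pow_le_one₀ (abs_nonneg _) this
    have h2 : fejerKernel x * x ^ 2 = 4 * Real.sin (x / 2) ^ 2 := by
      rw [fejerKernel, Real.sinc_of_ne_zero (by positivity)]
      field_simp
      ring
    nlinarith [Real.sin_sq_le_one (x / 2)]

theorem integral_fejerKernel_pos : 0 < ∫ x, fejerKernel x :=
  integral_pos_of_integrable_nonneg_nonzero (x := 0) continuous_fejerKernel
    integrable_fejerKernel fejerKernel_nonneg (by simp [fejerKernel_zero])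

/-- The Fejér kernel is the Fourier transform of the triangle function. -/
theorem integral_triangle_mul_cexp (x : ℝ) :
    ∫ t in Ioc (-1 : ℝ) 1, ((1 - |t| : ℝ) : ℂ) * Complex.exp (x * t * Complex.I) =
      (fejerKernel x : ℂ) := by
  rw [← intervalIntegral.integral_of_le (by norm_num)]
  have hint : ∀ a b : ℝ, IntervalIntegrable
      (fun t : ℝ => ((1 - |t| : ℝ) : ℂ) * Complex.exp (x * t * Complex.I)) volume a b := by
    intro a b
    exact Continuous.intervalIntegrable (by fun_prop) a b
  rw [← intervalIntegral.integral_add_adjacent_intervals (hint (-1) 0) (hint 0 1)]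
  have e1 : ∫ t in (-1 : ℝ)..0, ((1 - |t| : ℝ) : ℂ) * Complex.exp (x * t * Complex.I) =
      ∫ t in (-1 : ℝ)..0, (1 + t : ℂ) * Complex.exp (x * t * Complex.I) := by
    refine intervalIntegral.integral_congr fun t ht => ?_
    rw [uIcc_of_le (by norm_num)] at ht
    simp [abs_of_nonpos ht.2]
  have e2 : ∫ t in (0 : ℝ)..1, ((1 - |t| : ℝ) : ℂ) * Complex.exp (x * t * Complex.I) =
      ∫ t in (0 : ℝ)..1, (1 - t : ℂ) * Complex.exp (x * t * Complex.I) := by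
    refine intervalIntegral.integral_congr fun t ht => ?_
    rw [uIcc_of_le (by norm_num)] at ht
    simp [abs_of_nonneg ht.1]
  rw [e1, e2]
  rcases eq_or_ne x 0 with rfl | hx
  · have h1 := intervalIntegral.integral_eq_sub_of_hasDerivAt (a := -1) (b := 0)
      (f := fun t : ℝ => (t + t ^ 2 / 2 : ℂ)) (f' := fun t : ℝ => (1 + t : ℂ))
      (fun t _ => by
        have := (hasDerivAt_id (t : ℂ)).comp_ofReal
        have h := this.add ((this.pow 2).div_const 2)
        convert! h using 1
        simp) (Continuous.intervalIntegrable (by fun_prop) _ _)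
    have h2 := intervalIntegral.integral_eq_sub_of_hasDerivAt (a := 0) (b := 1)
      (f := fun t : ℝ => (t - t ^ 2 / 2 : ℂ)) (f' := fun t : ℝ => (1 - t : ℂ))
      (fun t _ => by
        have := (hasDerivAt_id (t : ℂ)).comp_ofReal
        have h := this.sub ((this.pow 2).div_const 2)
        convert! h using 1
        simp) (Continuous.intervalIntegrable (by fun_prop) _ _)
    simp only [Complex.ofReal_zero, zero_mul, Complex.exp_zero, mul_one]
    rw [h1, h2]
    norm_num [fejerKernel_zero]
  · have hc : (x : ℂ) * Complex.I ≠ 0 := by simp [hx]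
    have hx' : (x : ℂ) ≠ 0 := by simp [hx]
    have hexp : ∀ t : ℝ, HasDerivAt (fun t : ℝ => Complex.exp (x * t * Complex.I))
        (Complex.exp (x * t * Complex.I) * (x * Complex.I)) t := fun t => by
      have := (((hasDerivAt_id (t : ℂ)).comp_ofReal.const_mul (x : ℂ)).mul_const Complex.I).cexp
      simpa using! this
    have h1 := intervalIntegral.integral_eq_sub_of_hasDerivAt (a := -1) (b := 0)
      (f := fun t : ℝ => (1 + t : ℂ) * (Complex.exp (x * t * Complex.I) / (x * Complex.I))
        - Complex.exp (x * t * Complex.I) / (x * Complex.I) ^ 2)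
      (f' := fun t : ℝ => (1 + t : ℂ) * Complex.exp (x * t * Complex.I))
      (fun t _ => by
        have := ((hasDerivAt_id (t : ℂ)).comp_ofReal.const_add 1).mul
          ((hexp t).div_const (x * Complex.I))
        have h := this.sub ((hexp t).div_const ((x * Complex.I) ^ 2))
        convert! h using 1
        simp only [id]
        field_simp
        ring) (Continuous.intervalIntegrable (by fun_prop) _ _)
    have h2 := intervalIntegral.integral_eq_sub_of_hasDerivAt (a := 0) (b := 1)
      (f := fun t : ℝ => (1 - t : ℂ) * (Complex.exp (x * t * Complex.I) / (x * Complex.I))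
        + Complex.exp (x * t * Complex.I) / (x * Complex.I) ^ 2)
      (f' := fun t : ℝ => (1 - t : ℂ) * Complex.exp (x * t * Complex.I))
      (fun t _ => by
        have := ((hasDerivAt_id (t : ℂ)).comp_ofReal.const_sub 1).mul
          ((hexp t).div_const (x * Complex.I))
        have h := this.add ((hexp t).div_const ((x * Complex.I) ^ 2))
        convert! h using 1
        simp only [id]
        field_simp
        ring) (Continuous.intervalIntegrable (by fun_prop) _ _)
    rw [h1, h2]
    have hcos : Complex.exp (x * Complex.I) + Complex.exp (-(x * Complex.I)) =
        2 - 4 * (Real.sin (x / 2) : ℂ) ^ 2 := by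
      have h3 := Complex.two_cos (x : ℂ)
      have h4 := Complex.cos_two_mul ((x : ℂ) / 2)
      have h5 := Complex.sin_sq_add_cos_sq ((x : ℂ) / 2)
      rw [mul_div_cancel₀ _ two_ne_zero] at h4
      push_cast
      rw [neg_mul] at h3
      linear_combination -h3 + 2 * h4 + 4 * h5
    rw [fejerKernel, Real.sinc_of_ne_zero (by positivity)]
    push_cast at hcos ⊢
    have hI : ((x : ℂ) * Complex.I) ^ 2 = -(x : ℂ) ^ 2 := by
      rw [mul_pow, Complex.I_sq]; ring
    rw [hI]
    simp only [mul_zero, zero_mul, Complex.exp_zero, mul_one, mul_neg, neg_mul]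
    field_simp
    linear_combination -Complex.I * hcos

theorem integrableOn_bounded_mul_cexp {u : ℝ → ℝ} (hu : Measurable u) {B : ℝ}
    (hB : ∀ x, 0 < x → |u x| ≤ B) {z : ℂ} (hz : 0 < z.re) :
    IntegrableOn (fun x : ℝ => (u x : ℂ) * Complex.exp (-z * x)) (Ioi 0) := by
  refine Integrable.bdd_mul (c := B) (integrableOn_exp_mul_complex_Ioi (by simpa using hz) 0)
    (by fun_prop) ?_
  filter_upwards [ae_restrict_mem measurableSet_Ioi] with x hx
  simpa using hB x hx

theorem measurable_psi : Measurable Chebyshev.psi := Chebyshev.psi_mono.measurable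

theorem psi_exp_mul_exp_neg_le (x : ℝ) :
    Chebyshev.psi (Real.exp x) * Real.exp (-x) ≤ Real.log 4 + 4 := by
  have h := Chebyshev.psi_le_const_mul_self (Real.exp_pos x).le
  rw [Real.exp_neg, ← div_eq_mul_inv, div_le_iff₀ (Real.exp_pos x)]
  exact h

theorem psi_exp_mul_exp_neg_nonneg (x : ℝ) :
    0 ≤ Chebyshev.psi (Real.exp x) * Real.exp (-x) :=
  mul_nonneg (Chebyshev.psi_nonneg _) (Real.exp_pos _).le

theorem sum_vonMangoldt_isBigO :
    (fun n : ℕ => ∑ k ∈ Finset.Icc 1 n, Λ k) =O[atTop] fun n : ℕ => (n : ℝ) ^ (1 : ℝ) := by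
  refine Asymptotics.IsBigO.of_bound (Real.log 4 + 4) (.of_forall fun n => ?_)
  have h := Chebyshev.psi_le_const_mul_self (Nat.cast_nonneg (α := ℝ) n)
  have h0 := Chebyshev.psi_nonneg (n : ℝ)
  rw [Chebyshev.psi, Nat.floor_natCast] at h h0
  rw [Real.rpow_one, Real.norm_natCast]
  change ‖∑ k ∈ Finset.Ioc 0 n, Λ k‖ ≤ _
  rwa [Real.norm_of_nonneg h0]

/-- The continuous extension to `0 ≤ re z` of the Laplace transform of `ψ(eˣ) e⁻ˣ - 1`. -/
noncomputable def psiLaplace (z : ℂ) : ℂ :=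
  (vonMangoldt.LFunctionResidueClassAux (1 : ZMod 1) (1 + z) - 1) / (1 + z)

theorem continuousOn_psiLaplace : ContinuousOn psiLaplace {z | 0 ≤ z.re} := by
  refine ContinuousOn.div (ContinuousOn.sub ?_ continuousOn_const) (by fun_prop) ?_
  · refine (vonMangoldt.continuousOn_LFunctionResidueClassAux (1 : ZMod 1)).comp
      (by fun_prop) fun z hz => ?_
    simpa using hz
  · intro z hz h
    have := congrArg Complex.re h
    simp at this hz
    linarith

theorem laplace_psi_exp {z : ℂ} (hz : 0 < z.re) :
    ∫ x in Ioi (0 : ℝ), ((Chebyshev.psi (Real.exp x) * Real.exp (-x) - 1 : ℝ) : ℂ) *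
      Complex.exp (-z * x) = psiLaplace z := by
  have hre : 1 < (1 + z).re := by simpa using hz
  have hz0 : z ≠ 0 := by rintro rfl; simp at hz
  have hz1 : 1 + z ≠ 0 := by intro h; rw [h] at hre; simp at hre; linarith
  have hL := LSeries_eq_mul_integral_of_nonneg (fun n => Λ n) zero_le_one hre
    sum_vonMangoldt_isBigO fun n => vonMangoldt_nonneg
  have hA := vonMangoldt.eqOn_LFunctionResidueClassAux (q := 1) (a := 1) isUnit_one hre
  have hres : vonMangoldt.residueClass (1 : ZMod 1) = fun n => Λ n := by
    ext n
    simp [vonMangoldt.residueClass, Subsingleton.elim (n : ZMod 1) 1]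
  rw [hres] at hA
  beta_reduce at hA
  rw [hL, ← Real.exp_zero, ← integral_comp_exp_Ioi] at hA
  have hint : ∫ x in Ioi (0 : ℝ), Real.exp x • ((∑ k ∈ Finset.Icc 1 ⌊Real.exp x⌋₊, (Λ k : ℂ)) *
      (Real.exp x : ℂ) ^ (-(1 + z + 1))) =
      ∫ x in Ioi (0 : ℝ), ((Chebyshev.psi (Real.exp x) * Real.exp (-x) : ℝ) : ℂ) *
        Complex.exp (-z * x) := by
    congr 1 with x
    rw [Complex.cpow_def_of_ne_zero (by simp), ← Complex.ofReal_log (Real.exp_pos x).le,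
      Real.log_exp, Chebyshev.psi]
    change _ • ((∑ k ∈ Finset.Ioc 0 ⌊Real.exp x⌋₊, (Λ k : ℂ)) * _) = _
    push_cast
    have : Complex.exp ((x : ℂ) * (-(1 + z + 1))) =
        Complex.exp (-x) * Complex.exp (-x) * Complex.exp (-z * x) := by
      rw [← Complex.exp_add, ← Complex.exp_add]; ring_nf
    rw [this, Complex.real_smul, Complex.ofReal_exp]
    have h1 : Complex.exp (x : ℂ) * Complex.exp (-x) = 1 := by rw [← Complex.exp_add]; simp
    linear_combination (∑ k ∈ Finset.Ioc 0 ⌊Real.exp x⌋₊, (Λ k : ℂ)) * Complex.exp (-x) *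
      Complex.exp (-z * x) * h1
  rw [hint] at hA
  have h1 : ∫ x in Ioi (0 : ℝ), Complex.exp (-z * x) = 1 / z := by
    rw [integral_exp_mul_complex_Ioi (by simpa using hz)]
    simp
  have hmeas : Measurable fun x => Chebyshev.psi (Real.exp x) * Real.exp (-x) :=
    (measurable_psi.comp Real.measurable_exp).mul (by fun_prop)
  have i1 := integrableOn_bounded_mul_cexp (B := Real.log 4 + 4) hmeas (fun x _ => by
    rw [abs_of_nonneg (psi_exp_mul_exp_neg_nonneg x)]; exact psi_exp_mul_exp_neg_le x) hz
  have i2 : IntegrableOn (fun x : ℝ => Complex.exp (-z * x)) (Ioi 0) :=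
    integrableOn_exp_mul_complex_Ioi (by simpa using hz) 0
  have hsub : ∫ x in Ioi (0 : ℝ), ((Chebyshev.psi (Real.exp x) * Real.exp (-x) - 1 : ℝ) : ℂ) *
      Complex.exp (-z * x) = (∫ x in Ioi (0 : ℝ),
        ((Chebyshev.psi (Real.exp x) * Real.exp (-x) : ℝ) : ℂ) * Complex.exp (-z * x)) - 1 / z := by
    rw [← h1, ← integral_sub i1 i2]
    congr 1 with x
    push_cast
    ring
  rw [hsub, psiLaplace, hA]
  simp only [Nat.totient_one, Nat.cast_one, inv_one, add_sub_cancel_left]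
  field_simp
  ring

section FejerSmoothing

variable {u : ℝ → ℝ} {B : ℝ} {H : ℂ → ℂ} {c : ℝ}

theorem integral_damped_mul_fejerKernel (hu : Measurable u) (hB : ∀ x, 0 < x → |u x| ≤ B)
    (hL : ∀ z : ℂ, 0 < z.re →
      ∫ x in Ioi (0 : ℝ), (u x : ℂ) * Complex.exp (-z * x) = H z)
    {ε : ℝ} (hε : 0 < ε) (y : ℝ) :
    ∫ x in Ioi (0 : ℝ), (u x : ℂ) * Complex.exp (-ε * x) * (fejerKernel (c * (y - x)) : ℂ) =
      ∫ t in Ioc (-1 : ℝ) 1, ((1 - |t| : ℝ) : ℂ) * Complex.exp ((c * y : ℝ) * t * Complex.I) *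
        H (ε + c * t * Complex.I) := by
  have hre : ∀ t : ℝ, 0 < ((ε : ℂ) + c * t * Complex.I).re := fun t => by simpa using hε
  have hint : Integrable (Function.uncurry fun (x t : ℝ) =>
      (u x : ℂ) * Complex.exp (-ε * x) *
        (((1 - |t| : ℝ) : ℂ) * Complex.exp ((c * (y - x) : ℝ) * t * Complex.I)))
      ((volume.restrict (Ioi (0 : ℝ))).prod (volume.restrict (Ioc (-1 : ℝ) 1))) := by
    have h1 := integrableOn_bounded_mul_cexp hu hB (z := ε) (by simpa using hε)
    have h2 : IntegrableOn (fun t : ℝ => ((1 - |t| : ℝ) : ℂ)) (Ioc (-1) 1) :=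
      (Continuous.integrableOn_Icc (by fun_prop)).mono_set Ioc_subset_Icc_self
    have h3 := (h1.mul_prod h2).bdd_mul (c := 1)
      (f := fun p : ℝ × ℝ => Complex.exp ((c * (y - p.1) : ℝ) * p.2 * Complex.I))
      (by fun_prop) (.of_forall fun p => by
        rw [← Complex.ofReal_mul, Complex.norm_exp_ofReal_mul_I])
    refine h3.congr (.of_forall fun p => ?_)
    simp only [Function.uncurry]
    ring
  have hswap := integral_integral_swap hint
  simp only [integral_const_mul, integral_triangle_mul_cexp] at hswap
  rw [hswap]
  congr 1 with t
  rw [← hL _ (hre t), ← integral_const_mul]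
  congr 1 with x
  have : Complex.exp (-(ε : ℂ) * x) * Complex.exp ((c * (y - x) : ℝ) * t * Complex.I) =
      Complex.exp ((c * y : ℝ) * t * Complex.I) *
        Complex.exp (-(ε + c * t * Complex.I) * x) := by
    rw [← Complex.exp_add, ← Complex.exp_add]
    push_cast
    ring_nf
  linear_combination (u x : ℂ) * ((1 - |t| : ℝ) : ℂ) * this

theorem integrable_fejerKernel_mul_sub (hc : c ≠ 0) (y : ℝ) :
    Integrable fun x => fejerKernel (c * (y - x)) :=
  (integrable_fejerKernel.comp_mul_left' hc).comp_sub_left y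

theorem integral_mul_fejerKernel (hu : Measurable u) (hB : ∀ x, 0 < x → |u x| ≤ B)
    (hH : ContinuousOn H {z | 0 ≤ z.re})
    (hL : ∀ z : ℂ, 0 < z.re →
      ∫ x in Ioi (0 : ℝ), (u x : ℂ) * Complex.exp (-z * x) = H z)
    (hc : 0 < c) (y : ℝ) :
    ∫ x in Ioi (0 : ℝ), (u x : ℂ) * (fejerKernel (c * (y - x)) : ℂ) =
      ∫ t in Ioc (-1 : ℝ) 1, ((1 - |t| : ℝ) : ℂ) * Complex.exp ((c * y : ℝ) * t * Complex.I) *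
        H (c * t * Complex.I) := by
  have hle : ∀ {ε : ℝ}, 0 ≤ ε → ∀ t : ℝ, (ε : ℂ) + c * t * Complex.I ∈ {z : ℂ | 0 ≤ z.re} :=
    fun hε t => by simpa using hε
  have hleft : Tendsto (fun ε : ℝ => ∫ x in Ioi (0 : ℝ),
      (u x : ℂ) * Complex.exp (-ε * x) * (fejerKernel (c * (y - x)) : ℂ)) (𝓝[>] 0)
      (𝓝 (∫ x in Ioi (0 : ℝ), (u x : ℂ) * (fejerKernel (c * (y - x)) : ℂ))) := by
    refine tendsto_integral_filter_of_dominated_convergence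
      (fun x => B * fejerKernel (c * (y - x))) (.of_forall fun ε => by
        refine Measurable.aestronglyMeasurable ?_
        fun_prop) ?_ ((integrable_fejerKernel_mul_sub hc.ne' y).const_mul B).integrableOn ?_
    · filter_upwards [self_mem_nhdsWithin] with ε hε
      filter_upwards [ae_restrict_mem measurableSet_Ioi] with x hx
      have he : ‖Complex.exp (-(ε : ℂ) * x)‖ ≤ 1 := by
        rw [Complex.norm_exp]
        simpa using mul_nonneg (le_of_lt hε) (le_of_lt hx)
      rw [norm_mul, norm_mul, Complex.norm_real, Complex.norm_real, Real.norm_eq_abs,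
        Real.norm_of_nonneg (fejerKernel_nonneg _)]
      refine mul_le_mul_of_nonneg_right ?_ (fejerKernel_nonneg _)
      exact (mul_le_of_le_one_right (abs_nonneg _) he).trans (hB x hx)
    · refine .of_forall fun x => Tendsto.mono_left ?_ nhdsWithin_le_nhds
      have : Continuous fun ε : ℝ =>
          (u x : ℂ) * Complex.exp (-ε * x) * (fejerKernel (c * (y - x)) : ℂ) := by fun_prop
      simpa using this.tendsto 0
  have hright : Tendsto (fun ε : ℝ => ∫ t in Ioc (-1 : ℝ) 1, ((1 - |t| : ℝ) : ℂ) *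
      Complex.exp ((c * y : ℝ) * t * Complex.I) * H (ε + c * t * Complex.I)) (𝓝[>] 0)
      (𝓝 (∫ t in Ioc (-1 : ℝ) 1, ((1 - |t| : ℝ) : ℂ) *
        Complex.exp ((c * y : ℝ) * t * Complex.I) * H (c * t * Complex.I))) := by
    have hcont : ContinuousOn (fun p : ℝ × ℝ => H (p.1 + c * p.2 * Complex.I))
        (Icc 0 1 ×ˢ Icc (-1) 1) :=
      hH.comp (by fun_prop) fun p hp => hle hp.1.1 p.2
    obtain ⟨C, hC⟩ := (isCompact_Icc.prod isCompact_Icc).exists_bound_of_continuousOn hcont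
    refine tendsto_integral_filter_of_dominated_convergence (fun _ => C) ?_ ?_ (by simp) ?_
    · filter_upwards [self_mem_nhdsWithin] with ε hε
      refine Continuous.aestronglyMeasurable ?_
      refine Continuous.mul (by fun_prop) ?_
      exact hH.comp_continuous (by fun_prop) fun t => hle (le_of_lt hε) t
    · filter_upwards [Ioo_mem_nhdsGT (zero_lt_one (α := ℝ))] with ε hε
      filter_upwards [ae_restrict_mem measurableSet_Ioc] with t ht
      have h1 : abs (1 - |t|) ≤ 1 := by
        have := abs_le.2 ⟨ht.1.le, ht.2⟩
        rw [abs_le]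
        constructor <;> linarith [abs_nonneg t]
      rw [norm_mul, norm_mul, Complex.norm_real, Real.norm_eq_abs, ← Complex.ofReal_mul,
        Complex.norm_exp_ofReal_mul_I, mul_one]
      have h2 := hC (ε, t) ⟨⟨hε.1.le, hε.2.le⟩, ht.1.le, ht.2⟩
      exact (mul_le_of_le_one_left (norm_nonneg _) h1).trans h2
    · refine .of_forall fun t => Tendsto.const_mul _ ?_
      have h0 := hle le_rfl t
      have h1 : Tendsto (fun ε : ℝ => (ε : ℂ) + c * t * Complex.I) (𝓝[>] 0)
          (𝓝[{z : ℂ | 0 ≤ z.re}] ((0 : ℝ) + c * t * Complex.I)) := by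
        refine tendsto_nhdsWithin_iff.2 ⟨Tendsto.mono_left ?_ nhdsWithin_le_nhds, ?_⟩
        · exact Continuous.tendsto (by fun_prop) 0
        · filter_upwards [self_mem_nhdsWithin] with ε hε using hle (le_of_lt hε) t
      simpa [Function.comp_def] using (hH _ h0).tendsto.comp h1
  refine tendsto_nhds_unique hleft (hright.congr' ?_)
  filter_upwards [self_mem_nhdsWithin] with ε hε
  exact (integral_damped_mul_fejerKernel hu hB hL hε y).symm

theorem tendsto_integral_mul_fejerKernel (hu : Measurable u) (hB : ∀ x, 0 < x → |u x| ≤ B)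
    (hH : ContinuousOn H {z | 0 ≤ z.re})
    (hL : ∀ z : ℂ, 0 < z.re →
      ∫ x in Ioi (0 : ℝ), (u x : ℂ) * Complex.exp (-z * x) = H z)
    (hc : 0 < c) :
    Tendsto (fun y => ∫ x in Ioi (0 : ℝ), u x * fejerKernel (c * (y - x))) atTop (𝓝 0) := by
  have hRL := (Real.tendsto_integral_exp_smul_cocompact
    ((Ioc (-1 : ℝ) 1).indicator fun t => ((1 - |t| : ℝ) : ℂ) * H (c * t * Complex.I))).comp
    ((tendsto_id.const_mul_atTop_of_neg
      (show -(c / (2 * Real.pi)) < 0 by have := Real.pi_pos; simp; positivity)).mono_right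
      atBot_le_cocompact)
  rw [← tendsto_ofReal_iff, Complex.ofReal_zero]
  refine hRL.congr fun y => ?_
  have := integral_mul_fejerKernel hu hB hH hL hc y
  rw [← integral_complex_ofReal]
  push_cast at this ⊢
  rw [this, ← integral_indicator measurableSet_Ioc]
  simp only [Function.comp]
  congr 1 with t
  by_cases ht : t ∈ Ioc (-1 : ℝ) 1
  · simp only [indicator_of_mem ht, Circle.smul_def, Real.fourierChar_apply, smul_eq_mul, id]
    have : ((2 * Real.pi * -(t * (-(c / (2 * Real.pi)) * y)) : ℝ) : ℂ) = c * y * t := by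
      norm_cast
      field_simp
    rw [this]
    ring
  · simp [indicator_of_notMem ht]

end FejerSmoothing

section Tauberian

variable {c : ℝ}

theorem integral_fejerKernel_mul_sub (hc : 0 < c) (y : ℝ) :
    ∫ x, fejerKernel (c * (y - x)) = c⁻¹ * ∫ x, fejerKernel x := by
  rw [integral_sub_left_eq_self (fun x => fejerKernel (c * x)) volume y,
    Measure.integral_comp_mul_left, abs_of_pos (inv_pos.2 hc), smul_eq_mul]

theorem setIntegral_fejerKernel_mul_sub (hc : 0 < c) {δ : ℝ} (hδ : 0 < δ) (y : ℝ) :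
    ∫ x in Icc (y - δ) (y + δ), fejerKernel (c * (y - x)) =
      c⁻¹ * ∫ x in -(c * δ)..c * δ, fejerKernel x := by
  rw [integral_Icc_eq_integral_Ioc, ← intervalIntegral.integral_of_le (by linarith)]
  simp only [mul_sub]
  rw [intervalIntegral.integral_comp_sub_mul _ hc.ne', smul_eq_mul]
  ring_nf

variable {v : ℝ → ℝ} {B : ℝ}

theorem integrable_bounded_mul_fejerKernel (hv : Measurable v) (h0 : ∀ x, 0 ≤ v x)
    (hB : ∀ x, v x ≤ B) (hc : 0 < c) (y : ℝ) :
    Integrable fun x => v x * fejerKernel (c * (y - x)) := by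
  refine (integrable_fejerKernel_mul_sub hc.ne' y).bdd_mul (c := B) hv.aestronglyMeasurable
    (.of_forall fun x => ?_)
  rw [Real.norm_of_nonneg (h0 x)]
  exact hB x

theorem le_of_monotone_mul_exp (hmono : Monotone fun x => v x * Real.exp x)
    {x y d : ℝ} (h0 : 0 ≤ v y) (hxy : x ≤ y) (hd : y - x ≤ d) : v x ≤ v y * Real.exp d := by
  have h := hmono hxy
  have h1 : v x ≤ v y * Real.exp (y - x) := by
    rw [Real.exp_sub, ← mul_div_assoc, le_div_iff₀ (Real.exp_pos x)]
    exact h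
  exact h1.trans (mul_le_mul_of_nonneg_left (Real.exp_le_exp.2 hd) h0)

theorem integral_sub_one_mul_fejerKernel (hv : Measurable v) (h0 : ∀ x, 0 ≤ v x)
    (hB : ∀ x, v x ≤ B) (hc : 0 < c) (y : ℝ) :
    ∫ x in Ioi (0 : ℝ), (v x - 1) * fejerKernel (c * (y - x)) =
      (∫ x in Ioi (0 : ℝ), v x * fejerKernel (c * (y - x))) -
        ∫ x in Ioi (0 : ℝ), fejerKernel (c * (y - x)) := by
  rw [← integral_sub (integrable_bounded_mul_fejerKernel hv h0 hB hc y).integrableOn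
    (integrable_fejerKernel_mul_sub hc.ne' y).integrableOn]
  simp only [sub_mul, one_mul]

theorem mul_setIntegral_fejerKernel_le (hv : Measurable v) (h0 : ∀ x, 0 ≤ v x)
    (hB : ∀ x, v x ≤ B) (hmono : Monotone fun x => v x * Real.exp x) (hc : 0 < c)
    {δ : ℝ} (hδ : 0 < δ) {y : ℝ} (hy : δ < y) :
    v (y - δ) * (c⁻¹ * ∫ x in -(c * δ)..c * δ, fejerKernel x) ≤
      Real.exp (2 * δ) * ((∫ x in Ioi (0 : ℝ), (v x - 1) * fejerKernel (c * (y - x))) +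
        c⁻¹ * ∫ x, fejerKernel x) := by
  have hi := integrable_bounded_mul_fejerKernel hv h0 hB hc y
  have hk := integrable_fejerKernel_mul_sub hc.ne' y
  have hk0 : ∀ x, 0 ≤ fejerKernel (c * (y - x)) := fun x => fejerKernel_nonneg _
  have hsub : Icc (y - δ) (y + δ) ⊆ Ioi 0 := fun x hx => by
    have := hx.1
    simp only [mem_Ioi]
    linarith
  rw [integral_sub_one_mul_fejerKernel hv h0 hB hc, ← setIntegral_fejerKernel_mul_sub hc hδ y,
    ← integral_fejerKernel_mul_sub hc y]
  have h1 : ∫ x in Ioi (0 : ℝ), fejerKernel (c * (y - x)) ≤ ∫ x, fejerKernel (c * (y - x)) :=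
    setIntegral_le_integral hk (.of_forall hk0)
  have h2 : ∫ x in Icc (y - δ) (y + δ), v x * fejerKernel (c * (y - x)) ≤
      ∫ x in Ioi (0 : ℝ), v x * fejerKernel (c * (y - x)) :=
    setIntegral_mono_set hi.integrableOn (.of_forall fun x => mul_nonneg (h0 x) (hk0 x))
      hsub.eventuallyLE
  have h3 : v (y - δ) * ∫ x in Icc (y - δ) (y + δ), fejerKernel (c * (y - x)) ≤
      Real.exp (2 * δ) * ∫ x in Icc (y - δ) (y + δ), v x * fejerKernel (c * (y - x)) := by
    rw [← integral_const_mul, ← integral_const_mul]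
    refine setIntegral_mono_on (hk.const_mul _).integrableOn (hi.const_mul _).integrableOn
      measurableSet_Icc fun x hx => ?_
    have := le_of_monotone_mul_exp hmono (h0 x) hx.1 (d := 2 * δ) (by linarith [hx.2])
    nlinarith [hk0 x]
  exact h3.trans (mul_le_mul_of_nonneg_left (by linarith) (Real.exp_pos _).le)

theorem le_mul_integral_fejerKernel (hv : Measurable v) (h0 : ∀ x, 0 ≤ v x)
    (hB : ∀ x, v x ≤ B) (hmono : Monotone fun x => v x * Real.exp x) (hc : 0 < c)
    {δ : ℝ} (hδ : 0 < δ) {y : ℝ} (hy : δ < y) :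
    (∫ x in Ioi (0 : ℝ), (v x - 1) * fejerKernel (c * (y - x))) +
        c⁻¹ * ∫ x in -(c * δ)..c * δ, fejerKernel x ≤
      v (y + δ) * Real.exp (2 * δ) * (c⁻¹ * ∫ x, fejerKernel x) +
        B * (c⁻¹ * (∫ x, fejerKernel x) - c⁻¹ * ∫ x in -(c * δ)..c * δ, fejerKernel x) := by
  have hi := integrable_bounded_mul_fejerKernel hv h0 hB hc y
  have hk := integrable_fejerKernel_mul_sub hc.ne' y
  have hk0 : ∀ x, 0 ≤ fejerKernel (c * (y - x)) := fun x => fejerKernel_nonneg _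
  have hsub : Icc (y - δ) (y + δ) ⊆ Ioi 0 := fun x hx => by
    have := hx.1
    simp only [mem_Ioi]
    linarith
  rw [integral_sub_one_mul_fejerKernel hv h0 hB hc, ← setIntegral_fejerKernel_mul_sub hc hδ y,
    ← integral_fejerKernel_mul_sub hc y]
  set E := Icc (y - δ) (y + δ)
  have hBnn : 0 ≤ B := (h0 0).trans (hB 0)
  have h1 : ∫ x in Ioi (0 : ℝ), fejerKernel (c * (y - x)) ≤ ∫ x, fejerKernel (c * (y - x)) :=
    setIntegral_le_integral hk (.of_forall hk0)
  have h1' : ∫ x in E, fejerKernel (c * (y - x)) ≤ ∫ x, fejerKernel (c * (y - x)) :=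
    setIntegral_le_integral hk (.of_forall hk0)
  have h2 : ∫ x in E, fejerKernel (c * (y - x)) ≤ ∫ x in Ioi (0 : ℝ), fejerKernel (c * (y - x)) :=
    setIntegral_mono_set hk.integrableOn (.of_forall hk0) hsub.eventuallyLE
  have h3 : ∫ x in E, v x * fejerKernel (c * (y - x)) ≤
      v (y + δ) * Real.exp (2 * δ) * ∫ x in E, fejerKernel (c * (y - x)) := by
    rw [← integral_const_mul]
    refine setIntegral_mono_on hi.integrableOn (hk.const_mul _).integrableOn
      measurableSet_Icc fun x hx => mul_le_mul_of_nonneg_right ?_ (hk0 x)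
    exact le_of_monotone_mul_exp hmono (h0 _) hx.2 (by linarith [hx.1])
  have h4 : ∫ x in Ioi (0 : ℝ) \ E, v x * fejerKernel (c * (y - x)) ≤
      B * ∫ x in Ioi (0 : ℝ) \ E, fejerKernel (c * (y - x)) := by
    rw [← integral_const_mul]
    exact setIntegral_mono_on hi.integrableOn (hk.const_mul _).integrableOn
      (measurableSet_Ioi.diff measurableSet_Icc)
      fun x _ => mul_le_mul_of_nonneg_right (hB x) (hk0 x)
  rw [setIntegral_sdiff measurableSet_Icc hi.integrableOn hsub,
    setIntegral_sdiff measurableSet_Icc hk.integrableOn hsub] at h4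
  have h5 := mul_le_mul_of_nonneg_left h1' (mul_nonneg (h0 (y + δ)) (Real.exp_pos (2 * δ)).le)
  have h6 := mul_le_mul_of_nonneg_left h1 hBnn
  linarith

theorem tendsto_one_of_tendsto_integral_fejerKernel (hv : Measurable v) (h0 : ∀ x, 0 ≤ v x)
    (hB : ∀ x, v x ≤ B) (hmono : Monotone fun x => v x * Real.exp x)
    (hlim : ∀ c : ℝ, 0 < c → Tendsto
      (fun y => ∫ x in Ioi (0 : ℝ), (v x - 1) * fejerKernel (c * (y - x))) atTop (𝓝 0)) :
    Tendsto v atTop (𝓝 1) := by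
  set I := ∫ x, fejerKernel x with hI
  have hIpos : 0 < I := integral_fejerKernel_pos
  set m : ℝ → ℝ := fun R => ∫ x in -R..R, fejerKernel x with hm
  have hmlim : Tendsto m atTop (𝓝 I) :=
    intervalIntegral_tendsto_integral integrable_fejerKernel tendsto_neg_atTop_atBot tendsto_id
  have hmδ : Tendsto (fun δ : ℝ => m δ⁻¹) (𝓝[>] 0) (𝓝 I) :=
    hmlim.comp tendsto_inv_nhdsGT_zero
  have hexp : Tendsto (fun δ : ℝ => Real.exp (2 * δ)) (𝓝[>] 0) (𝓝 1) := by
    have : Continuous fun δ : ℝ => Real.exp (2 * δ) := by fun_prop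
    simpa using (this.tendsto 0).mono_left nhdsWithin_le_nhds
  have hup : Tendsto (fun δ : ℝ => Real.exp (2 * δ) * I / m δ⁻¹) (𝓝[>] 0) (𝓝 1) := by
    simpa [hIpos.ne'] using! (hexp.mul_const I).div hmδ hIpos.ne'
  have hlow : Tendsto (fun δ : ℝ => (m δ⁻¹ - B * (I - m δ⁻¹)) / (Real.exp (2 * δ) * I))
      (𝓝[>] 0) (𝓝 1) := by
    have h := (hmδ.sub ((hmδ.const_sub I).const_mul B)).div (hexp.mul_const I)
      (by simpa using hIpos.ne')
    simpa [hIpos.ne'] using! h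
  have hscale : ∀ {δ : ℝ}, 0 < δ → (δ ^ 2)⁻¹ * δ = δ⁻¹ := fun h => by field_simp
  refine tendsto_order.2 ⟨fun a ha => ?_, fun a ha => ?_⟩
  · obtain ⟨δ, h1, hδ⟩ := ((hlow.eventually_const_lt ha).and self_mem_nhdsWithin).exists
    set c : ℝ := (δ ^ 2)⁻¹ with hc
    have hcpos : 0 < c := by positivity
    have hl := ((((hlim c hcpos).const_mul c).add_const (m δ⁻¹ - B * (I - m δ⁻¹))).div_const
      (Real.exp (2 * δ) * I)).eventually_const_lt (by simpa using h1)
    rw [← map_add_atTop_eq δ, eventually_map]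
    filter_upwards [hl, eventually_gt_atTop δ] with y hy hyδ
    refine hy.trans_le ?_
    have h2 := le_mul_integral_fejerKernel hv h0 hB hmono hcpos hδ hyδ
    rw [hscale hδ] at h2
    rw [div_le_iff₀ (by positivity)]
    have h3 := mul_le_mul_of_nonneg_left h2 hcpos.le
    change c * (_ + c⁻¹ * m δ⁻¹) ≤ c * (_ * _ * (c⁻¹ * I) + B * (c⁻¹ * I - c⁻¹ * m δ⁻¹)) at h3
    have e1 : c * c⁻¹ = 1 := mul_inv_cancel₀ hcpos.ne'
    linear_combination h3 +
      (v (y + δ) * Real.exp (2 * δ) * I + B * (I - m δ⁻¹) - m δ⁻¹) * e1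
  · obtain ⟨δ, ⟨h1, hmpos⟩, hδ⟩ := (((hup.eventually_lt_const ha).and
      (hmδ.eventually_const_lt hIpos)).and self_mem_nhdsWithin).exists
    set c : ℝ := (δ ^ 2)⁻¹ with hc
    have hcpos : 0 < c := by positivity
    have hl := (((((hlim c hcpos).const_mul c).add_const I).const_mul
      (Real.exp (2 * δ))).div_const (m δ⁻¹)).eventually_lt_const (by simpa using h1)
    rw [← map_sub_atTop_eq δ, eventually_map]
    filter_upwards [hl, eventually_gt_atTop δ] with y hy hyδ
    refine lt_of_le_of_lt ?_ hy
    have h2 := mul_setIntegral_fejerKernel_le hv h0 hB hmono hcpos hδ hyδ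
    rw [hscale hδ] at h2
    rw [le_div_iff₀ hmpos]
    have h3 := mul_le_mul_of_nonneg_left h2 hcpos.le
    change c * (_ * (c⁻¹ * m δ⁻¹)) ≤ c * (_ * (_ + c⁻¹ * I)) at h3
    have e1 : c * c⁻¹ = 1 := mul_inv_cancel₀ hcpos.ne'
    linear_combination h3 + (Real.exp (2 * δ) * I - v (y - δ) * m δ⁻¹) * e1

end Tauberian

theorem chebyshevPsi_eq_psi (x : ℝ) : chebyshevPsi x = Chebyshev.psi x := by
  rw [chebyshevPsi, Chebyshev.psi]
  refine (Finset.sum_subset (fun n hn => ?_) fun n hn hn' => ?_).symm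
  · simp only [Finset.mem_Ioc, Finset.mem_Iic] at hn ⊢
    exact hn.2
  · simp only [Finset.mem_Ioc, Finset.mem_Iic, not_and] at hn hn'
    have : n = 0 := by
      by_contra h
      exact hn' (Nat.pos_of_ne_zero h) hn
    simp [this]

/-- The **Prime Number Theorem**, in terms of Chebyshev's function `ψ`. -/
theorem tendsto_chebyshevPsi_div :
    Tendsto (fun x : ℝ => chebyshevPsi x / x) atTop (𝓝 1) := by
  set v : ℝ → ℝ := fun x => Chebyshev.psi (Real.exp x) * Real.exp (-x) with hv
  have hmeas : Measurable v := (measurable_psi.comp Real.measurable_exp).mul (by fun_prop)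
  have hnn : ∀ x, 0 ≤ v x := psi_exp_mul_exp_neg_nonneg
  have hle : ∀ x, v x ≤ Real.log 4 + 4 := psi_exp_mul_exp_neg_le
  have hmono : Monotone fun x => v x * Real.exp x := by
    have : (fun x => v x * Real.exp x) = fun x => Chebyshev.psi (Real.exp x) := by
      ext x
      rw [hv, mul_assoc, ← Real.exp_add]
      simp
    rw [this]
    exact Chebyshev.psi_mono.comp Real.exp_monotone
  have hbound : ∀ x, 0 < x → |v x - 1| ≤ Real.log 4 + 4 := fun x _ => by
    have h4 : 0 ≤ Real.log 4 := Real.log_nonneg (by norm_num)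
    rw [abs_le]
    constructor <;> linarith [hnn x, hle x]
  have key := tendsto_one_of_tendsto_integral_fejerKernel hmeas hnn hle hmono fun c hc =>
    tendsto_integral_mul_fejerKernel (hmeas.sub_const 1) hbound continuousOn_psiLaplace
      (fun z hz => laplace_psi_exp hz) hc
  refine (key.comp Real.tendsto_log_atTop).congr' ?_
  filter_upwards [eventually_gt_atTop 0] with x hx
  simp only [Function.comp, hv]
  rw [Real.exp_neg, Real.exp_log hx, chebyshevPsi_eq_psi, div_eq_mul_inv]

theorem slowlyDecreasing_of_tendsto {u : ℝ → ℝ} {l : ℝ} (hu : Tendsto u atTop (𝓝 l)) :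
    SlowlyDecreasing u := by
  refine le_liminf_of_le (by isBoundedDefault) ?_
  filter_upwards [self_mem_nhdsWithin] with lam hlam
  have hpos : 0 < lam := zero_lt_one.trans hlam
  have h := (hu.comp (tendsto_id.const_mul_atTop hpos)).sub hu
  rw [sub_self] at h
  have h' := (continuous_coe_real_ereal.tendsto 0).comp h
  exact h'.liminf_eq.ge

/-- The Prime Number Theorem `ψ(x)/x → 1` holds if and only if the function
`x ↦ ψ(x)/x` is slowly decreasing at infinity. -/
theorem pnt_iff_chebyshevPsi_div_slowlyDecreasing :
    Tendsto (fun x : ℝ => chebyshevPsi x / x) atTop (nhds 1) ↔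
      SlowlyDecreasing (fun x : ℝ => chebyshevPsi x / x) :=
  ⟨slowlyDecreasing_of_tendsto, fun _ => tendsto_chebyshevPsi_div⟩
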